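/- Let L be a first-order language and let C be a finite L-structure. Then the following are equivalent: (i) the only idempotent endomorphism of C is the identity (C has no proper retracts); (ii) every endomorphism of C is injective. -/

import Mathlib

open FirstOrder FirstOrder.Language

theorem Function.exists_pos_iterate_idempotent {α : Type*} [Finite α] (f : α → α) :
    ∃ k, 0 < k ∧ f^[k] ∘ f^[k] = f^[k] := by
  obtain ⟨a, b, hab, h⟩ : ∃ a b, a < b ∧ f^[a] = f^[b] := by
    obtain ⟨a, b, hne, h⟩ := Finite.exists_ne_map_eq_of_infinite fun n : ℕ => f^[n]
    rcases hne.lt_or_gt with hlt | hlt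
    · exact ⟨a, b, hlt, h⟩
    · exact ⟨b, a, hlt, h.symm⟩
  obtain ⟨p, rfl⟩ := Nat.exists_eq_add_of_lt hab
  have periodic (n : ℕ) (hn : a ≤ n) : f^[n + (p + 1)] = f^[n] := by
    obtain ⟨c, rfl⟩ := Nat.exists_eq_add_of_le hn
    rw [show a + c + (p + 1) = c + (a + p + 1) by omega, Function.iterate_add, ← h,
      ← Function.iterate_add, Nat.add_comm]
  have periodic_mul (n m : ℕ) (hn : a ≤ n) : f^[n + m * (p + 1)] = f^[n] := by
    induction m with
    | zero => simp
    | succ m ih =>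
      rw [Nat.succ_mul, ← Nat.add_assoc, periodic _ (by omega), ih]
  refine ⟨(a + 1) * (p + 1), by positivity, ?_⟩
  rw [← Function.iterate_add]
  exact periodic_mul _ _ (by nlinarith)

theorem FirstOrder.Language.Hom.exists_coe_eq_iterate {L : FirstOrder.Language} {M : Type*}
    [L.Structure M] (h : M →[L] M) (n : ℕ) : ∃ g : M →[L] M, ⇑g = h^[n] := by
  induction n with
  | zero => exact ⟨Hom.id L M, rfl⟩
  | succ n ih =>
    obtain ⟨g, hg⟩ := ih
    exact ⟨g.comp h, by rw [Function.iterate_succ, ← hg]; rfl⟩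

/-- For a finite `L`-structure `C`, the following are equivalent: (i) the only idempotent
endomorphism of `C` is the identity (`C` has no proper retracts); (ii) every endomorphism
of `C` is injective. -/
theorem stmt_5 {L : FirstOrder.Language} {C : Type*} [L.Structure C] [Finite C] :
    (∀ h : C →[L] C, h.comp h = h → h = Hom.id L C) ↔
      ∀ h : C →[L] C, Function.Injective h := by
  refine ⟨fun H h => ?_, fun H h hh => ?_⟩
  · obtain ⟨k, hk, hidem⟩ := Function.exists_pos_iterate_idempotent h
    obtain ⟨g, hg⟩ := h.exists_coe_eq_iterate k
    have hid : g = Hom.id L C := H g (DFunLike.coe_injective (by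
      rw [← hg] at hidem
      exact hidem))
    obtain ⟨n, rfl⟩ := Nat.exists_eq_succ_of_ne_zero hk.ne'
    refine Function.Injective.of_comp (f := h^[n]) ?_
    rw [← Function.iterate_succ, ← hg, hid]
    exact Function.injective_id
  · ext x
    exact H h (DFunLike.congr_fun hh x)
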